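/- arXiv:1511.07055 — 2 statements merged into one kernel-verified Lean document; each statement's English description precedes it below -/
import Mathlib

section
/- Let g = ⊕_{p ≥ -1} g^p be a transitive nonlinear irreducible ℤ-graded finite-dimensional complex Lie algebra of depth 1. Then g is a simple Lie algebra; in particular g contains no nonzero abelian ideal. -/
theorem exists_mem_neg_one (L : Type*) [LieRing L] [LieAlgebra ℂ L]
    (g : ℤ → Submodule ℂ L)
    (hdirect : DirectSum.IsInternal g)
    (hbracket : ∀ p q : ℤ, ∀ x ∈ g p, ∀ y ∈ g q, ⁅x, y⁆ ∈ g (p + q))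
    (hdepth : ∀ p : ℤ, p < -1 → g p = ⊥)
    (htrans : ∀ p : ℤ, 0 ≤ p → ∀ x ∈ g p, (∀ y ∈ g (-1), ⁅x, y⁆ = 0) → x = 0)
    (J : LieIdeal ℂ L) (n : ℕ) : ∀ x ∈ J, x ≠ 0 → x ∈ (⨆ p : ℤ, ⨆ _ : p < n, g p) →
      ∃ z ∈ J, z ≠ 0 ∧ z ∈ g (-1) := by
  have hlow : ∀ n : ℤ, ∀ b ∈ (⨆ p : ℤ, ⨆ _ : p < n, g p), ∀ y ∈ g (-1),
      ⁅b, y⁆ ∈ (⨆ p : ℤ, ⨆ _ : p < n - 1, g p) := by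
    intro n b hb y hy
    have : (⨆ p : ℤ, ⨆ _ : p < n, g p) ≤
        (⨆ p : ℤ, ⨆ _ : p < n - 1, g p).comap (LieAlgebra.ad ℂ L y) := by
      refine iSup₂_le fun p hp c hc => ?_
      have h1 : ⁅y, c⁆ ∈ g (-1 + p) := hbracket _ _ y hy c hc
      have h2 : g (-1 + p) ≤ (⨆ p : ℤ, ⨆ _ : p < n - 1, g p) :=
        le_iSup₂_of_le (-1 + p) (by omega) le_rfl
      simpa using h2 h1
    have h := this hb
    rw [← lie_skew]
    exact neg_mem (by simpa using h)
  induction n with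
  | zero =>
    intro x hx hx0 hxm
    refine ⟨x, hx, hx0, ?_⟩
    have : (⨆ p : ℤ, ⨆ _ : p < ((0 : ℕ) : ℤ), g p) ≤ g (-1) := by
      refine iSup₂_le fun p hp => ?_
      rcases lt_or_eq_of_le (show p ≤ -1 by push_cast at hp; omega) with h | h
      · rw [hdepth p h]; exact bot_le
      · rw [h]
    exact this hxm
  | succ n ih =>
    intro x hx hx0 hxm
    have hle : (⨆ p : ℤ, ⨆ _ : p < ((n + 1 : ℕ) : ℤ), g p) ≤
        g n ⊔ (⨆ p : ℤ, ⨆ _ : p < (n : ℤ), g p) := by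
      refine iSup₂_le fun p hp => ?_
      rcases lt_or_eq_of_le (show p ≤ (n : ℤ) by push_cast at hp; omega) with h | h
      · exact le_sup_of_le_right (le_iSup₂_of_le p h le_rfl)
      · rw [h]; exact le_sup_left
    obtain ⟨a, ha, b, hb, rfl⟩ := Submodule.mem_sup.1 (hle hxm)
    by_cases ha0 : a = 0
    · subst ha0
      exact ih _ hx hx0 (by simpa using hb)
    · have : ∃ y ∈ g (-1), ⁅a, y⁆ ≠ 0 := by
        by_contra! hcon
        exact ha0 (htrans n (by omega) a ha hcon)
      obtain ⟨y, hy, hay⟩ := this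
      have hay' : ⁅a, y⁆ ∈ g ((n : ℤ) - 1) := hbracket _ _ a ha y hy
      have hby := hlow n b hb y hy
      refine ih ⁅a + b, y⁆ (lie_mem_left ℂ L J _ _ hx) ?_ ?_
      · intro h0
        rw [add_lie] at h0
        have hind := hdirect.submodule_iSupIndep ((n : ℤ) - 1)
        refine hay (Submodule.disjoint_def.1 hind _ hay' ?_)
        rw [eq_neg_of_add_eq_zero_left h0]
        refine neg_mem ((iSup₂_le fun p hp => ?_ :
          (⨆ p : ℤ, ⨆ _ : p < (n : ℤ) - 1, g p) ≤ _) hby)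
        exact le_iSup₂_of_le p (by omega) le_rfl
      · rw [add_lie]
        refine add_mem ?_ ?_
        · exact (le_iSup₂_of_le ((n : ℤ) - 1) (by omega) le_rfl :
            g ((n : ℤ) - 1) ≤ ⨆ p : ℤ, ⨆ _ : p < (n : ℤ), g p) hay'
        · exact (iSup₂_le fun p hp => le_iSup₂_of_le p (by omega) le_rfl :
            (⨆ p : ℤ, ⨆ _ : p < (n : ℤ) - 1, g p) ≤ ⨆ p : ℤ, ⨆ _ : p < (n : ℤ), g p) hby

theorem neg_one_le_ideal (L : Type*) [LieRing L] [LieAlgebra ℂ L]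
    (g : ℤ → Submodule ℂ L)
    (hdirect : DirectSum.IsInternal g)
    (hbracket : ∀ p q : ℤ, ∀ x ∈ g p, ∀ y ∈ g q, ⁅x, y⁆ ∈ g (p + q))
    (hdepth : ∀ p : ℤ, p < -1 → g p = ⊥)
    (htrans : ∀ p : ℤ, 0 ≤ p → ∀ x ∈ g p, (∀ y ∈ g (-1), ⁅x, y⁆ = 0) → x = 0)
    (hirr : ∀ m : Submodule ℂ L, m ≤ g (-1) →
      (∀ x ∈ g 0, ∀ v ∈ m, ⁅x, v⁆ ∈ m) → m = ⊥ ∨ m = g (-1))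
    (J : LieIdeal ℂ L) (hJ : J ≠ ⊥) : ∀ x ∈ g (-1), x ∈ J := by
  obtain ⟨x, hx, hx0⟩ : ∃ x ∈ J, x ≠ 0 := by
    by_contra! hcon
    exact hJ ((LieSubmodule.eq_bot_iff J).2 hcon)
  have hex : ∃ n : ℕ, x ∈ (⨆ p : ℤ, ⨆ _ : p < (n : ℤ), g p) := by
    have hmono : Monotone fun n : ℕ => (⨆ p : ℤ, ⨆ _ : p < (n : ℤ), g p) := by
      intro m n hmn
      exact iSup₂_le fun p hp => le_iSup₂_of_le p (by omega) le_rfl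
    have htop : (⊤ : Submodule ℂ L) ≤ ⨆ n : ℕ, (⨆ p : ℤ, ⨆ _ : p < (n : ℤ), g p) := by
      rw [← hdirect.submodule_iSup_eq_top]
      refine iSup_le fun p => le_iSup_of_le (p.toNat + 1) ?_
      exact le_iSup₂_of_le p (by omega) le_rfl
    exact (Submodule.mem_iSup_of_directed _ hmono.directed_le).1 (htop (Submodule.mem_top (x := x)))
  obtain ⟨n, hn⟩ := hex
  obtain ⟨z, hz, hz0, hzg⟩ :=
    exists_mem_neg_one L g hdirect hbracket hdepth htrans J n x hx hx0 hn
  rcases hirr (J.toSubmodule ⊓ g (-1)) inf_le_right (fun u hu v hv =>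
    ⟨lie_mem_right ℂ L J _ _ hv.1, by simpa using hbracket 0 (-1) u hu v hv.2⟩) with h | h
  · exact absurd ((Submodule.eq_bot_iff _).1 h z ⟨hz, hzg⟩) hz0
  · intro y hy
    rw [← h] at hy
    exact hy.1

theorem stmt14 (L : Type*) [LieRing L] [LieAlgebra ℂ L] [FiniteDimensional ℂ L]
    (g : ℤ → Submodule ℂ L)
    (hdirect : DirectSum.IsInternal g)
    (hbracket : ∀ p q : ℤ, ∀ x ∈ g p, ∀ y ∈ g q, ⁅x, y⁆ ∈ g (p + q))
    (hdepth : ∀ p : ℤ, p < -1 → g p = ⊥)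
    (hdepth1 : g (-1) ≠ ⊥)
    (htrans : ∀ p : ℤ, 0 ≤ p → ∀ x ∈ g p, (∀ y ∈ g (-1), ⁅x, y⁆ = 0) → x = 0)
    (hirr : ∀ m : Submodule ℂ L, m ≤ g (-1) →
      (∀ x ∈ g 0, ∀ v ∈ m, ⁅x, v⁆ ∈ m) → m = ⊥ ∨ m = g (-1))
    (hnonlin : g 1 ≠ ⊥) :
    LieAlgebra.IsSimple ℂ L ∧
    (∀ J : LieIdeal ℂ L, (∀ x ∈ J, ∀ y ∈ J, ⁅x, y⁆ = 0) → J = ⊥) := by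
  have key := neg_one_le_ideal L g hdirect hbracket hdepth htrans hirr
  have habel : ∀ J : LieIdeal ℂ L, (∀ x ∈ J, ∀ y ∈ J, ⁅x, y⁆ = 0) → J = ⊥ := by
    intro J hJ
    by_contra hne
    have hsub := key J hne
    obtain ⟨a, ha, ha0⟩ := Submodule.exists_mem_ne_zero_of_ne_bot hnonlin
    refine ha0 (htrans 1 (by norm_num) a ha fun y hy => ?_)
    have hmem : ⁅a, y⁆ ∈ J := lie_mem_right ℂ L J _ _ (hsub y hy)
    exact htrans 0 le_rfl _ (by simpa using hbracket 1 (-1) a ha y hy)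
      fun w hw => hJ _ hmem _ (hsub w hw)
  obtain ⟨v, hv, hv0⟩ := Submodule.exists_mem_ne_zero_of_ne_bot hdepth1
  refine ⟨?_, habel⟩
  have : LieAlgebra.HasTrivialRadical ℂ L := by
    rw [LieAlgebra.hasTrivialRadical_iff_no_abelian_ideals]
    intro I hI
    refine habel I fun x hx y hy => ?_
    have := hI.trivial ⟨x, hx⟩ ⟨y, hy⟩
    simpa using congrArg Subtype.val this
  refine ⟨fun I => ?_, fun hab => ?_⟩
  · have hc := LieIdeal.isCompl_killingCompl (K := ℂ) I
    by_cases hI : I = ⊥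
    · exact Or.inl hI
    right
    by_cases hI' : LieIdeal.killingCompl ℂ L I = ⊥
    · rw [hI'] at hc
      exact eq_top_of_isCompl_bot hc
    · exfalso
      have h1 : v ∈ I ⊓ LieIdeal.killingCompl ℂ L I :=
        LieSubmodule.mem_inf _ _ _ |>.2 ⟨key I hI v hv, key _ hI' v hv⟩
      rw [hc.inf_eq_bot] at h1
      exact hv0 (by simpa using h1)
  · have htop := habel ⊤ fun x _ y _ => hab.trivial x y
    have h1 : v ∈ (⊤ : LieIdeal ℂ L) := LieSubmodule.mem_top v
    rw [htop] at h1
    exact hv0 (by simpa using h1)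
end

section
/- Let g be a finite-dimensional complex simple Lie algebra with a ℤ-grading g = ⊕_p g^p of depth 1 (g^p = 0 for p < -1 and g^{-1} ≠ 0). Then the adjoint action of g^0 on g^{-1} is irreducible: every subspace m ⊆ g^{-1} with [g^0, m] ⊆ m equals 0 or g^{-1}. In particular, if x ∈ g^{-1} satisfies [g^0, x] = 0, then x = 0. -/
/-- Iterated brackets of elements of `m` with homogeneous elements of nonnegative degree. -/
inductive PosGen {L : Type*} [LieRing L] [LieAlgebra ℂ L] (g : ℤ → Submodule ℂ L)
    (m : Submodule ℂ L) : L → Prop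
  | base (v : L) (hv : v ∈ m) : PosGen g m v
  | step (p : ℤ) (hp : 0 ≤ p) (x : L) (hx : x ∈ g p) (w : L) (hw : PosGen g m w) :
      PosGen g m ⁅x, w⁆

/-- The nonnegative part of the grading. -/
def nonnegPart {L : Type*} [LieRing L] [LieAlgebra ℂ L] (g : ℤ → Submodule ℂ L) :
    Submodule ℂ L := ⨆ (p : ℤ) (_ : 0 ≤ p), g p

theorem le_nonnegPart {L : Type*} [LieRing L] [LieAlgebra ℂ L] (g : ℤ → Submodule ℂ L)
    (p : ℤ) (hp : 0 ≤ p) : g p ≤ nonnegPart g :=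
  le_iSup₂_of_le p hp le_rfl

theorem lie_mem_of_homog {L : Type*} [LieRing L] [LieAlgebra ℂ L] (g : ℤ → Submodule ℂ L)
    (htop : iSup g = ⊤) (N : Submodule ℂ L) (b : L)
    (h : ∀ p, ∀ x ∈ g p, ⁅x, b⁆ ∈ N) (a : L) : ⁅a, b⁆ ∈ N := by
  have ha : a ∈ iSup g := htop ▸ Submodule.mem_top
  induction ha using Submodule.iSup_induction' with
  | mem p x hx => exact h p x hx
  | zero => simp
  | add x y _ _ hx hy => rw [add_lie]; exact N.add_mem hx hy

theorem stmt18 (L : Type*) [LieRing L] [LieAlgebra ℂ L] [FiniteDimensional ℂ L]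
    [LieAlgebra.IsSimple ℂ L]
    (g : ℤ → Submodule ℂ L)
    (hdirect : DirectSum.IsInternal g)
    (hbracket : ∀ p q : ℤ, ∀ x ∈ g p, ∀ y ∈ g q, ⁅x, y⁆ ∈ g (p + q))
    (hdepth : ∀ p : ℤ, p < -1 → g p = ⊥)
    (hdepth1 : g (-1) ≠ ⊥) :
    (∀ m : Submodule ℂ L, m ≤ g (-1) →
      (∀ x ∈ g 0, ∀ v ∈ m, ⁅x, v⁆ ∈ m) → m = ⊥ ∨ m = g (-1)) ∧
    (∀ x ∈ g (-1), (∀ y ∈ g 0, ⁅y, x⁆ = 0) → x = 0) := by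
  have htop : iSup g = ⊤ := hdirect.submodule_iSup_eq_top
  have hdisj : Disjoint (g (-1)) (nonnegPart g) := by
    refine (hdirect.submodule_iSupIndep (-1)).mono_right ?_
    refine iSup₂_le fun p hp => ?_
    exact le_iSup₂_of_le p (by omega) le_rfl
  have hneg : ∀ p < -1, ∀ x ∈ g p, x = 0 := by
    intro p hp x hx
    rw [hdepth p hp] at hx
    simpa using hx
  have hD : ∀ p, 0 ≤ p → ∀ x ∈ g p, ∀ w ∈ nonnegPart g, ⁅x, w⁆ ∈ nonnegPart g := by
    intro p hp x hx w hw
    have : nonnegPart g ≤ (nonnegPart g).comap (LieAlgebra.ad ℂ L x) := by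
      refine iSup₂_le fun q hq y hy => ?_
      exact le_nonnegPart g (p + q) (by omega) (hbracket p q x hx y hy)
    exact this hw
  have key : ∀ m : Submodule ℂ L, m ≤ g (-1) →
      (∀ x ∈ g 0, ∀ v ∈ m, ⁅x, v⁆ ∈ m) → m = ⊥ ∨ m = g (-1) := by
    intro m hm hstab
    by_cases hm0 : m = ⊥
    · exact Or.inl hm0
    right
    -- generated elements lie in `m ⊔ D`
    have hle : ∀ w, PosGen g m w → w ∈ m ⊔ nonnegPart g := by
      intro w hw
      induction hw with
      | base v hv => exact Submodule.mem_sup_left hv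
      | step p hp x hx w _ ih =>
        obtain ⟨a, ha, b, hb, rfl⟩ := Submodule.mem_sup.1 ih
        rw [lie_add]
        refine Submodule.add_mem _ ?_ (Submodule.mem_sup_right (hD p hp x hx b hb))
        rcases hp.eq_or_lt with rfl | hp
        · exact Submodule.mem_sup_left (hstab x hx a ha)
        · exact Submodule.mem_sup_right (le_nonnegPart g (p + -1) (by omega)
            (hbracket _ _ x hx a (hm ha)))
    let I : Submodule ℂ L := Submodule.span ℂ {w | PosGen g m w}
    have hpos : ∀ p, 0 ≤ p → ∀ x ∈ g p, ∀ w ∈ I, ⁅x, w⁆ ∈ I := by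
      intro p hp x hx w hw
      induction hw using Submodule.span_induction with
      | mem w hw => exact Submodule.subset_span (PosGen.step p hp x hx w hw)
      | zero => simp
      | add a b _ _ ha hb => rw [lie_add]; exact I.add_mem ha hb
      | smul c a _ ha => rw [lie_smul]; exact I.smul_mem c ha
    have hgen : ∀ w, PosGen g m w → ∀ y ∈ g (-1), ⁅y, w⁆ ∈ I := by
      intro w hw
      induction hw with
      | base v hv =>
        intro y hy
        rw [hneg (-1 + -1) (by norm_num) _ (hbracket _ _ y hy v (hm hv))]
        exact I.zero_mem
      | step p hp x hx w hw ih =>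
        intro y hy
        rw [leibniz_lie]
        refine I.add_mem ?_ (hpos p hp x hx _ (ih y hy))
        have hyx := hbracket _ _ y hy x hx
        rcases hp.eq_or_lt with rfl | hp
        · exact ih _ (by simpa using hyx)
        · exact hpos (-1 + p) (by omega) _ hyx w (Submodule.subset_span hw)
    have hm1 : ∀ y ∈ g (-1), ∀ w ∈ I, ⁅y, w⁆ ∈ I := by
      intro y hy w hw
      induction hw using Submodule.span_induction with
      | mem w hw => exact hgen w hw y hy
      | zero => simp
      | add a b _ _ ha hb => rw [lie_add]; exact I.add_mem ha hb
      | smul c a _ ha => rw [lie_smul]; exact I.smul_mem c ha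
    have hI : ∀ a w : L, w ∈ I → ⁅a, w⁆ ∈ I := by
      intro a w hw
      refine lie_mem_of_homog g htop I w (fun p x hx => ?_) a
      rcases lt_trichotomy p (-1) with h | rfl | h
      · rw [hneg p h x hx]; simp
      · exact hm1 x hx w hw
      · exact hpos p (by omega) x hx w hw
    let J : LieIdeal ℂ L := { I with lie_mem := fun {a w} hw => hI a w hw }
    have hmJ : m ≤ I := fun v hv => Submodule.subset_span (PosGen.base v hv)
    have hItop : I = ⊤ := by
      rcases LieAlgebra.IsSimple.eq_bot_or_eq_top (R := ℂ) J with h | h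
      · exfalso
        apply hm0
        have : I = ⊥ := congrArg LieSubmodule.toSubmodule h
        exact le_bot_iff.1 (this ▸ hmJ)
      · exact congrArg LieSubmodule.toSubmodule h
    have hall : m ⊔ nonnegPart g = ⊤ := by
      rw [eq_top_iff, ← hItop]
      exact Submodule.span_le.2 hle
    refine le_antisymm hm fun y hy => ?_
    have hy' : y ∈ m ⊔ nonnegPart g := hall ▸ Submodule.mem_top
    obtain ⟨a, ha, b, hb, rfl⟩ := Submodule.mem_sup.1 hy'
    have hb1 : b ∈ g (-1) := by
      have := (g (-1)).sub_mem hy (hm ha)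
      simpa using this
    rw [Submodule.disjoint_def.1 hdisj b hb1 hb, add_zero]
    exact ha
  refine ⟨key, fun x hx h0 => ?_⟩
  rcases key (Submodule.span ℂ {x}) (by simpa using hx) (by
    intro y hy v hv
    obtain ⟨c, rfl⟩ := Submodule.mem_span_singleton.1 hv
    simp [h0 y hy]) with h | h
  · simpa using h
  exfalso
  have h01 : ∀ y ∈ g 0, ∀ v ∈ g (-1), ⁅y, v⁆ = 0 := by
    intro y hy v hv
    rw [← h] at hv
    obtain ⟨c, rfl⟩ := Submodule.mem_span_singleton.1 hv
    simp [h0 y hy]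
  have hhom : ∀ p q, ∀ a ∈ g p, ∀ b ∈ g q, ⁅a, b⁆ ∈ nonnegPart g := by
    intro p q a ha b hb
    have hab := hbracket p q a ha b hb
    rcases lt_trichotomy (p + q) (-1) with hs | hs | hs
    · rw [hneg _ hs _ hab]; exact Submodule.zero_mem _
    · by_cases hp : p < -1
      · rw [hneg p hp a ha]; simp
      by_cases hq : q < -1
      · rw [hneg q hq b hb]; simp
      have : (p = -1 ∧ q = 0) ∨ (p = 0 ∧ q = -1) := by omega
      rcases this with ⟨rfl, rfl⟩ | ⟨rfl, rfl⟩
      · rw [← lie_skew, h01 b hb a ha]; simp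
      · rw [h01 a ha b hb]; simp
    · exact le_nonnegPart g (p + q) (by omega) hab
  have hbr : ∀ a b : L, ⁅a, b⁆ ∈ nonnegPart g := by
    intro a b
    refine lie_mem_of_homog g htop _ b (fun p x hx => ?_) a
    rw [← lie_skew]
    refine Submodule.neg_mem _ ?_
    exact lie_mem_of_homog g htop _ x (fun q y hy => hhom q p y hy x hx) b
  let J : LieIdeal ℂ L := { nonnegPart g with lie_mem := fun {a w} _ => hbr a w }
  rcases LieAlgebra.IsSimple.eq_bot_or_eq_top (R := ℂ) J with hJ | hJ
  · have hb : nonnegPart g = ⊥ := congrArg LieSubmodule.toSubmodule hJ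
    apply LieAlgebra.IsSimple.non_abelian (R := ℂ) (L := L)
    refine ⟨fun a b => ?_⟩
    have := hbr a b
    rw [hb] at this
    simpa using this
  · have hb : nonnegPart g = ⊤ := congrArg LieSubmodule.toSubmodule hJ
    rw [hb] at hdisj
    exact hdepth1 (disjoint_top.1 hdisj)
end
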